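/- arXiv:1401.4415 — 3 statements merged into one kernel-verified Lean document; each statement's English description precedes it below -/
import Mathlib

section
/- Let E denote the intersection of the linear span of {e_u : u ∈ V} with D(S_λ). Then E is a core for S_λ: the closure (in ℓ²(V) × ℓ²(V)) of the graph of the restriction of S_λ to E equals the graph of S_λ. -/
open scoped ENNReal NNReal ComplexConjugate Classical ComplexInnerProductSpace

noncomputable section

/-- `HS V` is the Hilbert space `ℓ²(V)` of square-summable families of complex numbers
indexed by `V`. -/
abbrev HS (V : Type*) : Type _ := lp (fun _ : V => ℂ) 2

/-- A (possibly unbounded) partially defined operator in a Hilbert space `E`: a domain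
together with an assignment of values.  Only the restriction of `toFun` to `dom` is
relevant (e.g. via `POp.graph`). -/
structure POp (E : Type*) [NormedAddCommGroup E] [InnerProductSpace ℂ E] where
  dom : Set E
  toFun : E → E

namespace POp

variable {E : Type*} [NormedAddCommGroup E] [InnerProductSpace ℂ E]

/-- Composition of partially defined operators: `(A.comp B) f = A (B f)` on the natural
domain `{f ∈ dom B : B f ∈ dom A}`. -/
def comp (A B : POp E) : POp E :=
  ⟨{f | f ∈ B.dom ∧ B.toFun f ∈ A.dom}, fun f => A.toFun (B.toFun f)⟩

/-- The graph of a partially defined operator, as a subset of `E × E`. -/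
def graph (A : POp E) : Set (E × E) := {p | p.1 ∈ A.dom ∧ p.2 = A.toFun p.1}

/-- The Hilbert-space adjoint of a (densely defined) partially defined operator `A`:
`g ∈ dom A*` iff there is `h` with `⟪A f, g⟫ = ⟪f, h⟫` for all `f ∈ dom A`, and then
`A* g = h` (`h` is unique when `A` is densely defined). -/
def adj (A : POp E) : POp E :=
  ⟨{g | ∃ h : E, ∀ f ∈ A.dom, ⟪A.toFun f, g⟫ = ⟪f, h⟫},
   fun g => if h : ∃ h' : E, ∀ f ∈ A.dom, ⟪A.toFun f, g⟫ = ⟪f, h'⟫ then h.choose else 0⟩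

end POp

variable {V : Type*}

/-- The element of `ℓ²(V)` with coordinates `g` (junk value `0` if `g` is not
square-summable). -/
def mkH (g : V → ℂ) : HS V := if h : Memℓp g 2 then ⟨g, h⟩ else 0

/-- The standard orthonormal basis vector `e_u` of `ℓ²(V)`. -/
def eV (u : V) : HS V := mkH (fun v => if v = u then 1 else 0)

/-- The weighted shift `S_λ` on the directed tree encoded by the parent map `par`
(with `Chi(u) = {v : par v = u}`), with weights `lam`:
domain `{f : Σ_u (Σ_{v ∈ Chi(u)} |λ v|²)·|f u|² < ∞}` and value
`(S_λ f)(v) = λ v · f (par v)`. -/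
def shiftOp (par : V → V) (lam : V → ℂ) : POp (HS V) :=
  ⟨{f | ∑' u : V, ((∑' v : {v : V // par v = u}, ((‖lam v.1‖₊ : ℝ≥0∞) ^ 2)) *
        (‖f u‖₊ : ℝ≥0∞) ^ 2) < ⊤},
   fun f => mkH (fun v => lam v * f (par v))⟩

/-- `cW par lam u = (Σ_{v ∈ Chi(u)} |λ v|²)^{1/2}`, i.e. `c(u) = ‖S_λ e_u‖`. -/
def cW (par : V → V) (lam : V → ℂ) (u : V) : ℝ :=
  Real.sqrt (∑' v : {v : V // par v = u}, ‖lam v.1‖ ^ 2)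

theorem mkH_apply {g : V → ℂ} (hg : Memℓp g 2) (v : V) : mkH g v = g v := by
  rw [mkH, dif_pos hg]

theorem eV_eq_single (u : V) : eV u = lp.single 2 u (1 : ℂ) := by
  have h : (fun v => if v = u then (1 : ℂ) else 0) = ⇑(lp.single 2 u (1 : ℂ) : HS V) := by
    funext v
    simp [Pi.single_apply]
  ext v
  rw [eV, mkH_apply (h ▸ lp.memℓp _)]
  exact congrFun h v

theorem memℓp_two_iff_tsum_lt_top {g : V → ℂ} :
    Memℓp g 2 ↔ ∑' v, (‖g v‖₊ : ℝ≥0∞) ^ 2 < ⊤ := by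
  have h : ∑' v, (‖g v‖₊ : ℝ≥0∞) ^ 2 = ∑' v, ((‖g v‖₊ ^ 2 : ℝ≥0) : ℝ≥0∞) := by
    simp
  rw [memℓp_gen_iff (by simp), h, lt_top_iff_ne_top, ENNReal.tsum_coe_ne_top_iff_summable,
    ← NNReal.summable_coe]
  simp

/-- The domain of `S_λ` consists of those `f` for which `λ · (f ∘ par)` is square-summable. -/
theorem mem_dom_shiftOp_iff {par : V → V} {lam : V → ℂ} {f : HS V} :
    f ∈ (shiftOp par lam).dom ↔ Memℓp (fun v => lam v * f (par v)) 2 := by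
  have h : ∑' u : V, ((∑' v : {v : V // par v = u}, ((‖lam v.1‖₊ : ℝ≥0∞) ^ 2)) *
      (‖f u‖₊ : ℝ≥0∞) ^ 2) = ∑' v, (‖lam v * f (par v)‖₊ : ℝ≥0∞) ^ 2 := by
    rw [← ENNReal.tsum_fiberwise (fun v => (‖lam v * f (par v)‖₊ : ℝ≥0∞) ^ 2) par]
    refine tsum_congr fun u => ?_
    rw [← ENNReal.tsum_mul_right]
    refine tsum_congr fun v => ?_
    have hv : par v.1 = u := v.2
    rw [hv, nnnorm_mul, ENNReal.coe_mul, mul_pow]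
  rw [memℓp_two_iff_tsum_lt_top, ← h]
  rfl

theorem mem_graph_shiftOp_iff {par : V → V} {lam : V → ℂ} {p : HS V × HS V} :
    p ∈ (shiftOp par lam).graph ↔ ∀ v, p.2 v = lam v * p.1 (par v) := by
  constructor
  · rintro ⟨hdom, hval⟩ v
    rw [hval]
    exact mkH_apply (mem_dom_shiftOp_iff.1 hdom) v
  · intro h
    have hmem : Memℓp (fun v => lam v * p.1 (par v)) 2 := by
      simpa only [← funext h] using lp.memℓp p.2
    refine ⟨mem_dom_shiftOp_iff.2 hmem, lp.ext <| funext fun v => ?_⟩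
    rw [h v]
    exact (mkH_apply hmem v).symm

theorem isClosed_graph_shiftOp (par : V → V) (lam : V → ℂ) :
    IsClosed (shiftOp par lam).graph := by
  have heval (v : V) : Continuous fun f : HS V => f v :=
    (continuous_apply v).comp lp.uniformContinuous_coe.continuous
  have h : (shiftOp par lam).graph =
      ⋂ v, {p : HS V × HS V | p.2 v = lam v * p.1 (par v)} := by
    ext p
    simp [mem_graph_shiftOp_iff]
  rw [h]
  exact isClosed_iInter fun v => isClosed_eq ((heval v).comp continuous_snd)
    (continuous_const.mul ((heval (par v)).comp continuous_fst))

/-- The restriction of an element of `ℓ²(V)` to a set of coordinates. -/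
def restrictHS (s : Set V) (f : HS V) : HS V :=
  ⟨s.indicator f, (lp.memℓp f).mono' fun v => by
    by_cases hv : v ∈ s <;> simp [hv]⟩

theorem restrictHS_apply (s : Set V) (f : HS V) (v : V) :
    restrictHS s f v = s.indicator f v := rfl

theorem restrictHS_coe_finset (s : Finset V) (f : HS V) :
    restrictHS (s : Set V) f = ∑ u ∈ s, lp.single 2 u (f u) := by
  ext v
  rw [lp.coeFn_sum, Finset.sum_apply]
  simp [restrictHS_apply, Pi.single_apply, Set.indicator_apply]

theorem restrictHS_coe_finset_mem_span (s : Finset V) (f : HS V) :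
    restrictHS (s : Set V) f ∈ Submodule.span ℂ (Set.range (eV (V := V))) := by
  rw [restrictHS_coe_finset]
  refine Submodule.sum_mem _ fun u _ => ?_
  have h : (lp.single 2 u (f u) : HS V) = f u • eV u := by
    rw [eV_eq_single, ← lp.single_smul, smul_eq_mul, mul_one]
  rw [h]
  exact Submodule.smul_mem _ _ (Submodule.subset_span ⟨u, rfl⟩)

theorem norm_restrictHS_sub_le {s t : Set V} (hst : s ⊆ t) (f : HS V) :
    ‖restrictHS t f - f‖ ≤ ‖restrictHS s f - f‖ := by
  refine lp.norm_mono (by simp) fun v => ?_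
  by_cases ht : v ∈ t
  · simp [restrictHS_apply, ht]
  · have hs : v ∉ s := fun hs => ht (hst hs)
    simp [restrictHS_apply, ht, hs]

theorem tendsto_restrictHS (f : HS V) :
    Filter.Tendsto (fun s : Finset V => restrictHS (s : Set V) f) Filter.atTop (nhds f) := by
  simp only [restrictHS_coe_finset]
  exact lp.hasSum_single (by simp) f

theorem tendsto_restrictHS_preimage (par : V → V) (f : HS V) :
    Filter.Tendsto (fun s : Finset V => restrictHS (par ⁻¹' (s : Set V)) f)
      Filter.atTop (nhds f) := by
  rw [Metric.tendsto_atTop]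
  intro ε hε
  obtain ⟨t, ht⟩ := Metric.tendsto_atTop.1 (tendsto_restrictHS f) ε hε
  refine ⟨t.image par, fun s hs => ?_⟩
  have hts : (t : Set V) ⊆ par ⁻¹' (s : Set V) := fun v hv =>
    hs (Finset.mem_image_of_mem par hv)
  rw [dist_eq_norm]
  refine (norm_restrictHS_sub_le hts f).trans_lt ?_
  rw [← dist_eq_norm]
  exact ht t le_rfl

/-- Lemma 2.2: `E = span{e_u} ∩ D(S_λ)` is a core for the weighted
shift `S_λ`: the closure of the graph of `S_λ` restricted to `E` is the graph of `S_λ`. -/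
theorem statement_0 (V : Type*) [Nonempty V] (par : V → V)
    (ha : ∀ u v : V, ∃ m n : ℕ, par^[m] u = par^[n] v)
    (hb : ∀ (v : V) (n : ℕ), 1 ≤ n → par^[n] v ≠ v)
    (lam : V → ℂ) :
    closure (POp.graph
        (⟨(↑(Submodule.span ℂ (Set.range (eV (V := V)))) : Set (HS V)) ∩ (shiftOp par lam).dom,
          (shiftOp par lam).toFun⟩ : POp (HS V)))
      = POp.graph (shiftOp par lam) := by
  refine Set.Subset.antisymm
    (closure_minimal (fun p hp => ⟨hp.1.2, hp.2⟩) (isClosed_graph_shiftOp par lam)) ?_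
  rintro ⟨f, g⟩ hfg
  refine mem_closure_of_tendsto
    ((tendsto_restrictHS f).prodMk_nhds (tendsto_restrictHS_preimage par g))
    (Filter.Eventually.of_forall fun s => ?_)
  have hs : (restrictHS (s : Set V) f, restrictHS (par ⁻¹' (s : Set V)) g) ∈
      (shiftOp par lam).graph := by
    refine mem_graph_shiftOp_iff.2 fun v => ?_
    have hv := mem_graph_shiftOp_iff.1 hfg v
    by_cases h : par v ∈ s <;> simp_all [restrictHS_apply]
  exact ⟨⟨restrictHS_coe_finset_mem_span s f, hs.1⟩, hs.2⟩
end
end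

section
/- Let t ∈ (0,1) and let f ∈ ℓ²(ℕ) satisfy f(2k) ≠ 0 for every k ∈ ℕ. Define weights λ : ℕ → ℂ by λ(2k) = 0 and λ(2k+1) = |f(2k)|^{1/(t−1)} for k ∈ ℕ. Then S_λ is densely defined, μ(n) = 0 for all n (so S_μ is the zero operator with domain all of ℓ²(ℕ)), and f ∉ D(M_{1−t}); consequently D(Δ_t(S_λ)) = D(M_{1−t}) is a proper dense subspace of ℓ²(ℕ), so Δ_t(S_λ) is a proper restriction of S_μ and Δ_t(S_λ) is not a closed operator. -/
open scoped ENNReal NNReal ComplexConjugate Classical ComplexInnerProductSpace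

noncomputable section

variable {V : Type*}

/-- The multiplication operator `M_α` (representing `|S_λ|^α`): domain
`{f : Σ_u c(u)^{2α}·|f u|² < ∞}` and `(M_α f)(u) = c(u)^α·f(u)`. -/
def mulOp (par : V → V) (lam : V → ℂ) (α : ℝ) : POp (HS V) :=
  ⟨{f | Summable fun u : V => cW par lam u ^ (2 * α) * ‖f u‖ ^ 2},
   fun f => mkH (fun u => ((cW par lam u ^ α : ℝ) : ℂ) * f u)⟩

/-- The weights `π` of the partial isometry in the polar decomposition of `S_λ`:
`π v = λ v / c(par v)` if `c(par v) > 0`, and `π v = 0` otherwise. -/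
def piW (par : V → V) (lam : V → ℂ) (v : V) : ℂ :=
  if 0 < cW par lam (par v) then lam v / ((cW par lam (par v) : ℝ) : ℂ) else 0

/-- The partial isometry `S_π` of the polar decomposition of `S_λ`
(a contraction defined on all of `ℓ²(V)`). -/
def piOp (par : V → V) (lam : V → ℂ) : POp (HS V) :=
  ⟨Set.univ, fun f => mkH (fun v => piW par lam v * f (par v))⟩

/-- The weights `μ`: `μ v = (c v / c (par v))^t · λ v` if `c (par v) > 0`, else `0`. -/
def muW (par : V → V) (lam : V → ℂ) (t : ℝ) (v : V) : ℂ :=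
  if 0 < cW par lam (par v)
  then (((cW par lam v / cW par lam (par v)) ^ t : ℝ) : ℂ) * lam v else 0

/-- The `t`-Aluthge transform `Δ_t(S_λ) = M_t ∘ S_π ∘ M_{1-t} = |S_λ|^t S_π |S_λ|^{1-t}`. -/
def aluthge (par : V → V) (lam : V → ℂ) (t : ℝ) : POp (HS V) :=
  ((mulOp par lam t).comp (piOp par lam)).comp (mulOp par lam (1 - t))

/-- The parent map of the rooted directed tree `0 → 1 → 2 → ⋯` on `ℕ`:
`par 0 = 0` (root) and `par n = n - 1` for `n ≥ 1`. -/
def parN : ℕ → ℕ := fun n => n - 1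

theorem mkH_apply_eq_zero {g : V → ℂ} {v : V} (h : g v = 0) : mkH g v = 0 := by
  unfold mkH
  split_ifs
  · exact h
  · simp

theorem mkH_eq_zero {g : V → ℂ} (h : ∀ v, g v = 0) : mkH g = 0 :=
  lp.ext (funext fun v => by simpa using mkH_apply_eq_zero (h v))

/-- A set of vectors in `ℓ²(V)` containing all finitely supported ones is dense. -/
theorem dense_of_forall_finite_support {D : Set (HS V)}
    (hD : ∀ (s : Finset V) (g : HS V), (∀ v ∉ s, g v = 0) → g ∈ D) : Dense D := by
  intro g
  refine mem_closure_of_tendsto (lp.hasSum_single (by norm_num) g)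
    (Filter.Eventually.of_forall fun s => hD s _ fun v hv => ?_)
  rw [lp.coeFn_sum, Finset.sum_apply]
  refine Finset.sum_eq_zero fun i hi => ?_
  rw [lp.single_apply_ne]
  rintro rfl
  exact hv hi

theorem dense_mulOp_dom (par : V → V) (lam : V → ℂ) (α : ℝ) : Dense (mulOp par lam α).dom :=
  dense_of_forall_finite_support fun s _ hg =>
    summable_of_ne_finset_zero (s := s) fun v hv => by simp [hg v hv]

theorem dense_shiftOp_dom (par : V → V) (lam : V → ℂ)
    (hpar : ∀ u, Finite {v : V // par v = u}) : Dense (shiftOp par lam).dom := by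
  refine dense_of_forall_finite_support fun s g hg => ?_
  change (tsum _ : ℝ≥0∞) < ⊤
  rw [tsum_eq_sum (s := s) fun v hv => by simp [hg v hv]]
  refine ENNReal.sum_lt_top.2 fun u _ => ENNReal.mul_lt_top ?_ (by simp)
  have := Fintype.ofFinite {v : V // par v = u}
  rw [tsum_fintype]
  exact ENNReal.sum_lt_top.2 fun v _ => by simp

theorem finite_children_parN (u : ℕ) : Finite {v : ℕ // parN v = u} :=
  ((Set.finite_Iic (u + 1)).subset fun v (hv : v - 1 = u) => by
    simp only [Set.mem_Iic]; omega).to_subtype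

theorem cW_parN {lam : ℕ → ℂ} (h0 : lam 0 = 0) (u : ℕ) : cW parN lam u = ‖lam (u + 1)‖ := by
  unfold cW
  rw [tsum_eq_single ⟨u + 1, by simp [parN]⟩, Real.sqrt_sq (norm_nonneg _)]
  rintro ⟨v, hv⟩ hne
  have hne' : v ≠ u + 1 := fun h => hne (Subtype.ext h)
  have hv0 : v = 0 := by
    simp only [parN] at hv
    omega
  simp [hv0, h0]

theorem shiftOp_dom_of_eq_zero (par : V → V) {lam : V → ℂ} (h : ∀ v, lam v = 0) :
    (shiftOp par lam).dom = Set.univ :=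
  Set.eq_univ_of_forall fun g => by simp [shiftOp, h]

theorem shiftOp_toFun_of_eq_zero (par : V → V) {lam : V → ℂ} (h : ∀ v, lam v = 0) (g : HS V) :
    (shiftOp par lam).toFun g = 0 :=
  mkH_eq_zero fun v => by simp [h v]

section AlternatingWeights

variable {lam : V → ℂ} {par : V → V}

theorem muW_eq_zero {t : ℝ} (ht : t ≠ 0) (h : ∀ v, lam v = 0 ∨ cW par lam v = 0) (v : V) :
    muW par lam t v = 0 := by
  rcases h v with h | h <;> simp [muW, h, Real.zero_rpow ht]

theorem piOp_apply_eq_zero_or (h : ∀ v, lam v = 0 ∨ cW par lam v = 0) (g : HS V) (v : V) :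
    (piOp par lam).toFun g v = 0 ∨ cW par lam v = 0 :=
  (h v).imp_left fun h => mkH_apply_eq_zero (by simp [piW, h])

theorem aluthge_dom {t : ℝ} (ht : t ≠ 0) (h : ∀ v, lam v = 0 ∨ cW par lam v = 0) :
    (aluthge par lam t).dom = (mulOp par lam (1 - t)).dom := by
  refine Set.ext fun g => ⟨fun hg => hg.1, fun hg => ⟨hg, trivial, ?_⟩⟩
  refine summable_zero.congr fun v => ?_
  rcases piOp_apply_eq_zero_or h ((mulOp par lam (1 - t)).toFun g) v with h | h <;>
    simp [h, Real.zero_rpow, ht]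

theorem aluthge_toFun {t : ℝ} (ht : t ≠ 0) (h : ∀ v, lam v = 0 ∨ cW par lam v = 0) (g : HS V) :
    (aluthge par lam t).toFun g = 0 := by
  refine mkH_eq_zero fun v => ?_
  rcases piOp_apply_eq_zero_or h ((mulOp par lam (1 - t)).toFun g) v with h | h <;>
    simp [h, Real.zero_rpow, ht]

end AlternatingWeights

/-- A restriction of the zero operator to a proper dense subset is not closed. -/
theorem POp.not_isClosed_graph {E : Type*} [NormedAddCommGroup E] [InnerProductSpace ℂ E]
    {A : POp E} (hzero : ∀ g, A.toFun g = 0) (hdense : Dense A.dom) (hne : A.dom ≠ Set.univ) :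
    ¬ IsClosed A.graph := by
  intro hcl
  have hpre : (fun g : E => (g, (0 : E))) ⁻¹' A.graph = A.dom := by
    ext g
    simp [POp.graph, hzero]
  have hdom : IsClosed A.dom := hpre ▸ hcl.preimage (by fun_prop)
  exact hne (hdom.closure_eq ▸ hdense.closure_eq)

/-- Example 4.4: for `t ∈ (0,1)` and `f ∈ ℓ²(ℕ)` with `f(2k) ≠ 0` for
all `k`, the weights `λ(2k) = 0`, `λ(2k+1) = |f(2k)|^{1/(t-1)}` give a densely defined
weighted shift `S_λ` with `μ = 0` (so `S_μ` is the zero operator on all of `ℓ²`), while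
`f ∉ D(M_{1-t})`; consequently `D(Δ_t(S_λ)) = D(M_{1-t})` is a proper dense subspace,
`Δ_t(S_λ)` is a proper restriction of `S_μ`, and `Δ_t(S_λ)` is not closed. -/
theorem statement_8 (t : ℝ) (ht : t ∈ Set.Ioo (0 : ℝ) 1) (f : HS ℕ)
    (hf : ∀ k : ℕ, f (2 * k) ≠ 0)
    (lam : ℕ → ℂ)
    (hlam0 : ∀ k : ℕ, lam (2 * k) = 0)
    (hlam1 : ∀ k : ℕ, lam (2 * k + 1) = ((‖f (2 * k)‖ ^ ((1 : ℝ) / (t - 1)) : ℝ) : ℂ)) :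
    Dense (shiftOp parN lam).dom ∧
    (∀ n : ℕ, muW parN lam t n = 0) ∧
    (shiftOp parN (muW parN lam t)).dom = Set.univ ∧
    (∀ g : HS ℕ, (shiftOp parN (muW parN lam t)).toFun g = 0) ∧
    f ∉ (mulOp parN lam (1 - t)).dom ∧
    (aluthge parN lam t).dom = (mulOp parN lam (1 - t)).dom ∧
    Dense (mulOp parN lam (1 - t)).dom ∧
    (mulOp parN lam (1 - t)).dom ≠ Set.univ ∧
    POp.graph (aluthge parN lam t) ⊆ POp.graph (shiftOp parN (muW parN lam t)) ∧
    POp.graph (aluthge parN lam t) ≠ POp.graph (shiftOp parN (muW parN lam t)) ∧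
    ¬ IsClosed (POp.graph (aluthge parN lam t)) := by
  have ht0 : t ≠ 0 := ht.1.ne'
  have ht1 : 1 - t ≠ 0 := sub_ne_zero.2 ht.2.ne'
  have hc := cW_parN (hlam0 0)
  have halt : ∀ n, lam n = 0 ∨ cW parN lam n = 0 := by
    intro n
    rcases Nat.even_or_odd' n with ⟨k, rfl | rfl⟩
    · exact Or.inl (hlam0 k)
    · right
      rw [hc, show 2 * k + 1 + 1 = 2 * (k + 1) by ring, hlam0, norm_zero]
  have hterm (k : ℕ) : cW parN lam (2 * k) ^ (2 * (1 - t)) * ‖f (2 * k)‖ ^ 2 = 1 := by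
    have hpos : 0 < ‖f (2 * k)‖ := norm_pos_iff.2 (hf k)
    rw [hc, hlam1, Complex.norm_real, Real.norm_of_nonneg (by positivity), ← Real.rpow_mul hpos.le,
      show 1 / (t - 1) * (2 * (1 - t)) = -2 by
        have : t - 1 ≠ 0 := sub_ne_zero.2 ht.2.ne
        field_simp
        ring,
      ← Real.rpow_natCast, ← Real.rpow_add hpos]
    norm_num
  have hfdom : f ∉ (mulOp parN lam (1 - t)).dom := by
    intro h
    have hs := h.comp_injective (i := fun k : ℕ => 2 * k) fun a b hab => by simpa using hab
    exact one_ne_zero ((summable_const_iff (1 : ℝ)).1 (hs.congr fun k => hterm k))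
  have hmu := muW_eq_zero ht0 halt
  have hAdom := aluthge_dom ht0 halt
  have hAzero := aluthge_toFun ht0 halt
  have hSdom := shiftOp_dom_of_eq_zero parN hmu
  have hSzero := shiftOp_toFun_of_eq_zero parN hmu
  have hdense := dense_mulOp_dom parN lam (1 - t)
  have hne : (mulOp parN lam (1 - t)).dom ≠ Set.univ := fun h => hfdom (h ▸ Set.mem_univ f)
  refine ⟨dense_shiftOp_dom parN lam finite_children_parN, hmu, hSdom, hSzero, hfdom, hAdom,
    hdense, hne, ?_, fun h => ?_, ?_⟩
  · rintro ⟨g, h⟩ ⟨-, hgh⟩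
    exact ⟨hSdom ▸ Set.mem_univ g, by rw [hgh, hAzero, hSzero]⟩
  · have hmem : (f, (0 : HS ℕ)) ∈ POp.graph (aluthge parN lam t) :=
      h ▸ ⟨hSdom ▸ Set.mem_univ f, (hSzero f).symm⟩
    exact hfdom (hAdom ▸ hmem.1)
  · exact POp.not_isClosed_graph hAzero (hAdom ▸ hdense) (hAdom ▸ hne)
end
end

section
/- The operator S_π is defined on all of ℓ²(V) and is a partial isometry: ‖S_π f‖ ≤ ‖f‖ for every f ∈ ℓ²(V), ‖S_π f‖ = ‖f‖ for every f in the closed linear span of {e_u : c(u) > 0}, and S_π e_u = 0 whenever c(u) = 0. Moreover S_λ = S_π ∘ M_1: D(S_λ) = D(M_1) and S_λ f = S_π(M_1 f) for every f ∈ D(S_λ); that is, S_λ = S_π |S_λ| is the polar decomposition of S_λ. -/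
open scoped ENNReal NNReal ComplexConjugate Classical ComplexInnerProductSpace

noncomputable section

variable {V : Type*}

/-- The square of the `ℓ²`-norm of an arbitrary family, as an extended nonnegative real. -/
def sqSum (g : V → ℂ) : ℝ≥0∞ := ∑' v, (‖g v‖₊ : ℝ≥0∞) ^ 2

theorem memlp_two_iff_summable_sq {g : V → ℂ} :
    Memℓp g 2 ↔ Summable fun v => ‖g v‖ ^ 2 := by
  rw [memℓp_gen_iff (by norm_num)]
  norm_num

theorem coe_nnnorm_sq_eq_ofReal (z : ℂ) : (‖z‖₊ : ℝ≥0∞) ^ 2 = ENNReal.ofReal (‖z‖ ^ 2) := by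
  rw [ENNReal.ofReal_pow (norm_nonneg _), ofReal_norm, enorm_eq_nnnorm]

theorem tsum_ofReal_lt_top_iff {ι : Type*} {f : ι → ℝ} (hf : ∀ i, 0 ≤ f i) :
    ∑' i, ENNReal.ofReal (f i) < ⊤ ↔ Summable f := by
  refine ⟨fun h => ?_, fun h => h.tsum_ofReal_lt_top⟩
  simpa [ENNReal.toReal_ofReal (hf _)] using ENNReal.summable_toReal h.ne

theorem sqSum_lt_top_iff {g : V → ℂ} : sqSum g < ⊤ ↔ Memℓp g 2 := by
  simp only [sqSum, coe_nnnorm_sq_eq_ofReal, memlp_two_iff_summable_sq]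
  exact tsum_ofReal_lt_top_iff fun _ => by positivity

theorem ofReal_norm_sq_eq_sqSum (f : HS V) : ENNReal.ofReal (‖f‖ ^ 2) = sqSum f := by
  have hs : Summable fun v => ‖f v‖ ^ 2 := memlp_two_iff_summable_sq.1 (lp.memℓp f)
  have h := lp.norm_rpow_eq_tsum (p := 2) (by norm_num) f
  norm_num at h
  simp only [sqSum, coe_nnnorm_sq_eq_ofReal]
  rw [h, ENNReal.ofReal_tsum_of_nonneg (fun _ => by positivity) hs]

theorem ofReal_norm_mkH_sq {g : V → ℂ} (hg : Memℓp g 2) :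
    ENNReal.ofReal (‖mkH g‖ ^ 2) = sqSum g := by
  rw [ofReal_norm_sq_eq_sqSum]
  exact congrArg sqSum (funext (mkH_apply hg))

theorem memlp_indicator_singleton (u : V) :
    Memℓp (fun v : V => if v = u then (1 : ℂ) else 0) 2 := by
  refine memlp_two_iff_summable_sq.2 (summable_of_ne_finset_zero (s := {u}) fun v hv => ?_)
  simp_all

theorem eV_apply (u v : V) : eV u v = if v = u then 1 else 0 :=
  mkH_apply (memlp_indicator_singleton u) v

/-- Summing a weighted shift of `f` along the fibres of the parent map. -/
theorem sqSum_weighted_comp (par : V → V) (w f : V → ℂ) :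
    sqSum (fun v => w v * f (par v)) =
      ∑' u : V, (∑' v : {v : V // par v = u}, (‖w v.1‖₊ : ℝ≥0∞) ^ 2) * (‖f u‖₊ : ℝ≥0∞) ^ 2 := by
  rw [sqSum, ← (Equiv.sigmaFiberEquiv par).tsum_eq, ENNReal.tsum_sigma']
  refine tsum_congr fun u => ?_
  rw [← ENNReal.tsum_mul_right]
  refine tsum_congr fun v => ?_
  simp [Equiv.sigmaFiberEquiv, v.2, mul_pow]

section Weights

variable {par : V → V} {lam : V → ℂ}

theorem cW_nonneg (u : V) : 0 ≤ cW par lam u := Real.sqrt_nonneg _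

theorem cW_sq (u : V) : cW par lam u ^ 2 = ∑' v : {v : V // par v = u}, ‖lam v.1‖ ^ 2 :=
  Real.sq_sqrt (tsum_nonneg fun _ => by positivity)

theorem tsum_fiber_eq_ofReal_cW_sq {u : V}
    (hl : Summable fun v : {v : V // par v = u} => ‖lam v.1‖ ^ 2) :
    ∑' v : {v : V // par v = u}, (‖lam v.1‖₊ : ℝ≥0∞) ^ 2 = ENNReal.ofReal (cW par lam u ^ 2) := by
  simp only [coe_nnnorm_sq_eq_ofReal]
  rw [cW_sq, ENNReal.ofReal_tsum_of_nonneg (fun _ => by positivity) hl]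

theorem weight_eq_zero_of_cW_eq_zero {v : V}
    (hl : Summable fun w : {w : V // par w = par v} => ‖lam w.1‖ ^ 2)
    (h : cW par lam (par v) = 0) : lam v = 0 := by
  have h0 : HasSum (fun w : {w : V // par w = par v} => ‖lam w.1‖ ^ 2) 0 := by
    rw [hl.hasSum_iff, ← cW_sq, h, zero_pow two_ne_zero]
  have h1 := (hasSum_zero_iff_of_nonneg fun _ => by positivity).1 h0
  simpa using congrFun h1 ⟨v, rfl⟩

theorem piW_mul_cW {v : V}
    (hl : Summable fun w : {w : V // par w = par v} => ‖lam w.1‖ ^ 2) :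
    piW par lam v * ((cW par lam (par v) : ℝ) : ℂ) = lam v := by
  rcases (cW_nonneg (par := par) (lam := lam) (par v)).eq_or_lt' with h | h
  · rw [weight_eq_zero_of_cW_eq_zero hl h, h]
    simp
  · rw [piW, if_pos h, div_mul_cancel₀]
    exact_mod_cast h.ne'

theorem tsum_fiber_piW {u : V}
    (hl : Summable fun v : {v : V // par v = u} => ‖lam v.1‖ ^ 2) :
    ∑' v : {v : V // par v = u}, (‖piW par lam v.1‖₊ : ℝ≥0∞) ^ 2 =
      if 0 < cW par lam u then 1 else 0 := by
  split_ifs with h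
  · have hv (v : {v : V // par v = u}) : (‖piW par lam v.1‖₊ : ℝ≥0∞) ^ 2 =
        (‖lam v.1‖₊ : ℝ≥0∞) ^ 2 * ENNReal.ofReal ((cW par lam u ^ 2)⁻¹) := by
      rw [piW, v.2, if_pos h, coe_nnnorm_sq_eq_ofReal, coe_nnnorm_sq_eq_ofReal,
        ← ENNReal.ofReal_mul (by positivity), norm_div, Complex.norm_real,
        Real.norm_of_nonneg h.le, div_pow, div_eq_mul_inv]
    rw [tsum_congr hv, ENNReal.tsum_mul_right, tsum_fiber_eq_ofReal_cW_sq hl,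
      ← ENNReal.ofReal_mul (by positivity), mul_inv_cancel₀ (by positivity), ENNReal.ofReal_one]
  · refine ENNReal.tsum_eq_zero.2 fun v => ?_
    simp [piW, v.2, h]

theorem sqSum_piW_comp
    (hl : ∀ u : V, Summable fun v : {v : V // par v = u} => ‖lam v.1‖ ^ 2)
    (f : V → ℂ) :
    sqSum (fun v => piW par lam v * f (par v)) =
      ∑' u : V, (if 0 < cW par lam u then 1 else 0) * (‖f u‖₊ : ℝ≥0∞) ^ 2 := by
  rw [sqSum_weighted_comp]
  exact tsum_congr fun u => by rw [tsum_fiber_piW (hl u)]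

theorem sqSum_piW_comp_le
    (hl : ∀ u : V, Summable fun v : {v : V // par v = u} => ‖lam v.1‖ ^ 2)
    (f : V → ℂ) :
    sqSum (fun v => piW par lam v * f (par v)) ≤ sqSum f := by
  rw [sqSum_piW_comp hl]
  refine ENNReal.tsum_le_tsum fun u => ?_
  split_ifs <;> simp

theorem memlp_piW_comp
    (hl : ∀ u : V, Summable fun v : {v : V // par v = u} => ‖lam v.1‖ ^ 2)
    (f : HS V) : Memℓp (fun v => piW par lam v * f (par v)) 2 :=
  sqSum_lt_top_iff.1 <| (sqSum_piW_comp_le hl f).trans_lt (sqSum_lt_top_iff.2 (lp.memℓp f))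

theorem norm_piOp_le
    (hl : ∀ u : V, Summable fun v : {v : V // par v = u} => ‖lam v.1‖ ^ 2)
    (f : HS V) : ‖(piOp par lam).toFun f‖ ≤ ‖f‖ := by
  have h : ENNReal.ofReal (‖(piOp par lam).toFun f‖ ^ 2) ≤ ENNReal.ofReal (‖f‖ ^ 2) := by
    rw [piOp, ofReal_norm_mkH_sq (memlp_piW_comp hl f), ofReal_norm_sq_eq_sqSum]
    exact sqSum_piW_comp_le hl f
  rwa [ENNReal.ofReal_le_ofReal_iff (by positivity),
    sq_le_sq₀ (norm_nonneg _) (norm_nonneg _)] at h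

theorem norm_piOp_eq
    (hl : ∀ u : V, Summable fun v : {v : V // par v = u} => ‖lam v.1‖ ^ 2)
    {f : HS V} (hf : ∀ u, ¬ 0 < cW par lam u → f u = 0) :
    ‖(piOp par lam).toFun f‖ = ‖f‖ := by
  have h : ENNReal.ofReal (‖(piOp par lam).toFun f‖ ^ 2) = ENNReal.ofReal (‖f‖ ^ 2) := by
    rw [piOp, ofReal_norm_mkH_sq (memlp_piW_comp hl f), ofReal_norm_sq_eq_sqSum,
      sqSum_piW_comp hl]
    refine tsum_congr fun u => ?_
    split_ifs with hu
    · simp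
    · simp [hf u hu]
  rwa [ENNReal.ofReal_eq_ofReal_iff (by positivity) (by positivity),
    sq_eq_sq₀ (norm_nonneg _) (norm_nonneg _)] at h

theorem shiftOp_dom_eq_mulOp_dom
    (hl : ∀ u : V, Summable fun v : {v : V // par v = u} => ‖lam v.1‖ ^ 2) : (shiftOp par lam).dom = (mulOp par lam 1).dom := by
  ext f
  have h (u : V) : (∑' v : {v : V // par v = u}, (‖lam v.1‖₊ : ℝ≥0∞) ^ 2) *
      (‖f u‖₊ : ℝ≥0∞) ^ 2 = ENNReal.ofReal (cW par lam u ^ (2 * 1 : ℝ) * ‖f u‖ ^ 2) := by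
    rw [tsum_fiber_eq_ofReal_cW_sq (hl u), coe_nnnorm_sq_eq_ofReal,
      ← ENNReal.ofReal_mul (by positivity), mul_one, Real.rpow_two]
  simp only [shiftOp, mulOp, Set.mem_ofPred_eq]
  rw [tsum_congr h]
  exact tsum_ofReal_lt_top_iff fun u =>
    mul_nonneg (Real.rpow_nonneg (cW_nonneg u) _) (by positivity)

theorem shiftOp_eq_piOp_mulOp
    (hl : ∀ u : V, Summable fun v : {v : V // par v = u} => ‖lam v.1‖ ^ 2)
    {f : HS V} (hf : f ∈ (mulOp par lam 1).dom) :
    (shiftOp par lam).toFun f = (piOp par lam).toFun ((mulOp par lam 1).toFun f) := by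
  have hm : Memℓp (fun u => ((cW par lam u ^ (1 : ℝ) : ℝ) : ℂ) * f u) 2 := by
    refine memlp_two_iff_summable_sq.2 (Summable.congr hf fun u => ?_)
    rw [norm_mul, mul_pow, Complex.norm_real, Real.norm_eq_abs, sq_abs, mul_one, Real.rpow_two,
      Real.rpow_one]
  refine congrArg mkH (funext fun v => ?_)
  have hv : (mulOp par lam 1).toFun f (par v) = ((cW par lam (par v) : ℝ) : ℂ) * f (par v) :=
    (mkH_apply hm (par v)).trans (by rw [Real.rpow_one])
  rw [hv, ← mul_assoc, piW_mul_cW (hl (par v))]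

end Weights

theorem apply_eq_zero_of_mem_closure_span {s : Set V} {f : HS V}
    (hf : f ∈ closure (↑(Submodule.span ℂ (eV '' s)) : Set (HS V))) {u : V} (hu : u ∉ s) :
    f u = 0 := by
  let φ : HS V →L[ℂ] ℂ := lp.evalCLM ℂ (fun _ : V => ℂ) 2 u
  have hle : Submodule.span ℂ (eV '' s) ≤ LinearMap.ker φ.toLinearMap := by
    refine Submodule.span_le.2 ?_
    rintro _ ⟨w, hw, rfl⟩
    have huw : u ≠ w := fun h => hu (h ▸ hw)
    change eV w u = 0
    rw [eV_apply, if_neg huw]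
  exact closure_minimal hle φ.isClosed_ker hf

theorem piOp_eV_eq_zero {par : V → V} {lam : V → ℂ} {u : V} (hu : cW par lam u = 0) :
    (piOp par lam).toFun (eV u) = 0 := by
  have h : (fun v => piW par lam v * eV u (par v)) = 0 := by
    funext v
    by_cases hv : par v = u
    · simp [piW, hv, hu]
    · simp [eV_apply, hv]
  refine (congrArg mkH h).trans (lp.ext (funext fun v => ?_))
  exact mkH_apply zero_memℓp v

/-- Proposition 3.2: `S_π` is defined on all of `ℓ²(V)` and is a
partial isometry (a contraction, isometric on the closed span of `{e_u : c(u) > 0}`,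
and vanishing on `e_u` when `c(u) = 0`), and `S_λ = S_π ∘ M_1 = S_π |S_λ|` is the polar
decomposition of `S_λ`. -/
theorem statement_18 (V : Type*) [Nonempty V] (par : V → V)
    (ha : ∀ u v : V, ∃ m n : ℕ, par^[m] u = par^[n] v)
    (hb : ∀ (v : V) (n : ℕ), 1 ≤ n → par^[n] v ≠ v)
    (lam : V → ℂ)
    (hl : ∀ u : V, Summable fun v : {v : V // par v = u} => ‖lam v.1‖ ^ 2) :
    (piOp par lam).dom = Set.univ ∧
    (∀ f : HS V, Memℓp (fun v : V => piW par lam v * f (par v)) 2) ∧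
    (∀ f : HS V, ‖(piOp par lam).toFun f‖ ≤ ‖f‖) ∧
    (∀ f : HS V,
      f ∈ closure (↑(Submodule.span ℂ (eV '' {u : V | 0 < cW par lam u})) : Set (HS V)) →
      ‖(piOp par lam).toFun f‖ = ‖f‖) ∧
    (∀ u : V, cW par lam u = 0 → (piOp par lam).toFun (eV u) = 0) ∧
    (shiftOp par lam).dom = (mulOp par lam 1).dom ∧
    (∀ f ∈ (shiftOp par lam).dom,
      (shiftOp par lam).toFun f = (piOp par lam).toFun ((mulOp par lam 1).toFun f)) := by
  exact ⟨rfl, memlp_piW_comp hl, norm_piOp_le hl,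
    fun f hf => norm_piOp_eq hl fun u hu => apply_eq_zero_of_mem_closure_span hf hu,
    fun u hu => piOp_eV_eq_zero hu, shiftOp_dom_eq_mulOp_dom hl,
    fun f hf => shiftOp_eq_piOp_mulOp hl (shiftOp_dom_eq_mulOp_dom hl ▸ hf)⟩
end
end
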